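/- Let β > 1, s₀ > 0, M ≥ 0, and let w ∈ C²([0, s₀]) be nonnegative, non-decreasing with w(0) = 0 and w(s) ≤ M for all s ∈ [0,s₀]. Then 4 ∫₀^{s₀} (s₀ − s)^β s w''(s) ds ≥ −4 s₀^β M. -/

import Mathlib

open Set Real MeasureTheory intervalIntegral

theorem i1_lower_bound
    (β s₀ M : ℝ) (hβ : β > 1) (hs₀ : 0 < s₀) (hM : 0 ≤ M)
    (w w' w'' : ℝ → ℝ)
    (hd1 : ∀ s ∈ Icc 0 s₀, HasDerivWithinAt w (w' s) (Icc 0 s₀) s)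
    (hd2 : ∀ s ∈ Icc 0 s₀, HasDerivWithinAt w' (w'' s) (Icc 0 s₀) s)
    (hc2 : ContinuousOn w'' (Icc 0 s₀))
    (hnonneg : ∀ s ∈ Icc 0 s₀, 0 ≤ w s)
    (hmono : MonotoneOn w (Icc 0 s₀))
    (hw0 : w 0 = 0)
    (hbdd : ∀ s ∈ Icc 0 s₀, w s ≤ M) :
    4 * ∫ s in (0:ℝ)..s₀, (s₀ - s) ^ β * s * w'' s ≥ -4 * s₀ ^ β * M := by
  have hu : uIcc 0 s₀ = Icc 0 s₀ := uIcc_of_le hs₀.le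
  have hφ : ∀ s : ℝ, HasDerivAt (fun s : ℝ => (s₀ - s) ^ β * s)
      ((-1) * β * (s₀ - s) ^ (β - 1) * s + (s₀ - s) ^ β * 1) s := by
    intro s
    have h1 : HasDerivAt (fun s : ℝ => s₀ - s) (-1) s := by
      simpa using (hasDerivAt_id s).const_sub s₀
    exact (h1.rpow_const (Or.inr hβ.le)).mul (hasDerivAt_id s)
  have hcφ : Continuous (fun s : ℝ => (-1) * β * (s₀ - s) ^ (β - 1) * s + (s₀ - s) ^ β * 1) := by
    have h1 : Continuous (fun s : ℝ => (s₀ - s) ^ (β - 1)) :=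
      (continuous_const.sub continuous_id).rpow_const (fun _ => Or.inr (by linarith))
    have h2 : Continuous (fun s : ℝ => (s₀ - s) ^ β) :=
      (continuous_const.sub continuous_id).rpow_const (fun _ => Or.inr (by linarith))
    fun_prop
  have hcw' : ContinuousOn w' (uIcc 0 s₀) := by
    rw [hu]; exact fun s hs => (hd2 s hs).continuousWithinAt
  have hiw' : IntervalIntegrable w' volume 0 s₀ := hcw'.intervalIntegrable
  have hiw'' : IntervalIntegrable w'' volume 0 s₀ :=
    ContinuousOn.intervalIntegrable (by rwa [hu])
  have hw'0 : ∀ s ∈ Icc 0 s₀, 0 ≤ w' s := by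
    intro s hs
    have := hmono.derivWithin_nonneg (x := s)
    rwa [(hd1 s hs).derivWithin (uniqueDiffOn_Icc hs₀ s hs)] at this
  have hparts := integral_mul_deriv_eq_deriv_mul_of_hasDerivWithinAt (a := 0) (b := s₀)
    (fun s _ => (hφ s).hasDerivWithinAt) (by rw [hu]; exact hd2)
    (hcφ.intervalIntegrable _ _) hiw''
  have hftc : ∫ s in (0:ℝ)..s₀, w' s = w s₀ - w 0 := by
    apply integral_eq_sub_of_hasDerivAt_of_le hs₀.le (fun s hs => (hd1 s hs).continuousWithinAt)
      (fun s hs => (hd1 s (Ioo_subset_Icc_self hs)).hasDerivAt (Icc_mem_nhds hs.1 hs.2)) hiw'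
  have hle : ∫ s in (0:ℝ)..s₀, ((-1) * β * (s₀ - s) ^ (β - 1) * s + (s₀ - s) ^ β * 1) * w' s
      ≤ ∫ s in (0:ℝ)..s₀, s₀ ^ β * w' s := by
    apply integral_mono_on hs₀.le
    · exact (hcφ.continuousOn.mul hcw').intervalIntegrable
    · exact hiw'.const_mul _
    · intro s hs
      apply mul_le_mul_of_nonneg_right _ (hw'0 s hs)
      have h0 : 0 ≤ s₀ - s := by linarith [hs.2]
      have h1 : (s₀ - s) ^ β ≤ s₀ ^ β :=
        Real.rpow_le_rpow h0 (by linarith [hs.1]) (by linarith)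
      have h2 : 0 ≤ β * (s₀ - s) ^ (β - 1) * s :=
        mul_nonneg (mul_nonneg (by linarith) (Real.rpow_nonneg h0 _)) hs.1
      linarith
  rw [intervalIntegral.integral_const_mul, hftc, hw0, sub_zero] at hle
  have hM' : s₀ ^ β * w s₀ ≤ s₀ ^ β * M :=
    mul_le_mul_of_nonneg_left (hbdd s₀ ⟨hs₀.le, le_rfl⟩) (Real.rpow_nonneg hs₀.le _)
  rw [sub_self, Real.zero_rpow (by linarith)] at hparts
  rw [hparts]
  linarith
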